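/- Let Q = (−1,1)^n and let F : Q × (0,1) → ℝ^m be a definable mapping such that sup_{x ∈ Q} ‖F(x,s)‖ → 0 as s → 0+. Then for every ε > 0 there exists δ > 0 such that for every s ∈ (0,δ) there is a nonempty open set Ω = Ω(s) ⊆ Q with the property that for every x ∈ Ω the map x' ↦ F(x',s) is differentiable at x and the Frobenius norm of its Jacobian matrix ∇_x F(x,s) (the square root of the sum of squares of all partial derivatives ∂F^i/∂x_j(x,s)) is strictly less than ε. -/

import Mathlib

open Filter Metric Set Topology FirstOrder
open scoped ENNReal NNReal

noncomputable section

/-- The modulus of surjection `Sur F(x,y)(λ)`: the supremum of the radii `r ∈ [0,∞]`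
such that the closed ball of radius `r` around `y` is contained in the image under `F`
of the closed ball of radius `lam` around `x` (with `sup ∅ = 0`). -/
def surMod {X Y : Type*} [PseudoMetricSpace X] [PseudoMetricSpace Y]
    (F : X → Set Y) (x : X) (y : Y) (lam : ℝ) : ℝ≥0∞ :=
  sSup {r : ℝ≥0∞ | {v : Y | edist v y ≤ r} ⊆ ⋃ u ∈ Metric.closedBall x lam, F u}

/-- The rate of surjection `sur F(x̄|ȳ) = liminf_{(x,y,λ)→(x̄,ȳ,0+)} Sur F(x,y)(λ)/λ`. -/
def surRate {X Y : Type*} [PseudoMetricSpace X] [PseudoMetricSpace Y]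
    (F : X → Set Y) (xb : X) (yb : Y) : ℝ≥0∞ :=
  Filter.liminf
    (fun p : (X × Y) × ℝ => surMod F p.1.1 p.1.2 p.2 / ENNReal.ofReal p.2)
    ((𝓝 (xb, yb)) ×ˢ (𝓝[>] (0 : ℝ)))

/-- The graph of a set-valued mapping. -/
def svGraph {X Y : Type*} (F : X → Set Y) : Set (X × Y) := {p | p.2 ∈ F p.1}

/-- `y` is a critical value of `F` : there is `x` with `y ∈ F(x)` and `sur F(x|y) = 0`. -/
def IsCriticalValue {X Y : Type*} [PseudoMetricSpace X] [PseudoMetricSpace Y]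
    (F : X → Set Y) (y : Y) : Prop :=
  ∃ x, y ∈ F x ∧ surRate F x y = 0

/-- Definability (with parameters from `ℝ`) of a set of tuples. -/
def DefinableT (L : FirstOrder.Language) [L.Structure ℝ] {α : Type}
    (s : Set (α → ℝ)) : Prop :=
  (Set.univ : Set ℝ).Definable L s

/-- The o-minimality hypotheses: the order, addition and multiplication are definable and
every definable subset of `ℝ` is a finite union of points and open intervals. -/
structure IsOMinimalOn (L : FirstOrder.Language) [L.Structure ℝ] : Prop where
  definable_lt : DefinableT L {v : Fin 2 → ℝ | v 0 < v 1}
  definable_add : DefinableT L {v : Fin 3 → ℝ | v 2 = v 0 + v 1}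
  definable_mul : DefinableT L {v : Fin 3 → ℝ | v 2 = v 0 * v 1}
  finite_union : ∀ s : Set ℝ, DefinableT L {v : Fin 1 → ℝ | v 0 ∈ s} →
    ∃ (P : Finset ℝ) (I : Finset (EReal × EReal)),
      s = ↑P ∪ ⋃ p ∈ (I : Set (EReal × EReal)), {x : ℝ | p.1 < (x : EReal) ∧ (x : EReal) < p.2}

/-- Coding of a subset of `ℝⁿ × ℝᵐ` as a set of tuples. -/
def codeProd {n m : ℕ} (S : Set (EuclideanSpace ℝ (Fin n) × EuclideanSpace ℝ (Fin m))) :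
    Set (Fin n ⊕ Fin m → ℝ) :=
  {v | ((WithLp.equiv 2 (Fin n → ℝ)).symm fun i => v (Sum.inl i),
        (WithLp.equiv 2 (Fin m → ℝ)).symm fun j => v (Sum.inr j)) ∈ S}

/-- Coding of a subset of `ℝᵐ` as a set of tuples. -/
def codeE {m : ℕ} (S : Set (EuclideanSpace ℝ (Fin m))) : Set (Fin m → ℝ) :=
  {v | (WithLp.equiv 2 (Fin m → ℝ)).symm v ∈ S}

/-- A set of tuples is tame if its intersection with every bounded definable set is
definable. -/
def TameT (L : FirstOrder.Language) [L.Structure ℝ] {α : Type} [Fintype α]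
    (s : Set (α → ℝ)) : Prop :=
  ∀ b : Set (α → ℝ), DefinableT L b → Bornology.IsBounded b → DefinableT L (s ∩ b)

/-- A porous set in a metric space. -/
def Porous {X : Type*} [PseudoMetricSpace X] (Q : Set X) : Prop :=
  ∃ lam > (0 : ℝ), ∀ x ∈ Q, ∀ r > (0 : ℝ),
    ∃ z, Metric.ball z (lam * r) ⊆ Metric.ball x r \ Q

/-- A σ-porous set: a countable union of porous sets. -/
def SigmaPorous {X : Type*} [PseudoMetricSpace X] (Q : Set X) : Prop :=
  ∃ f : ℕ → Set X, (∀ i, Porous (f i)) ∧ Q = ⋃ i, f i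


section DefinabilityCalculus

variable {L : FirstOrder.Language} [L.Structure ℝ] {α β : Type}

/-- A predicate on tuples of reals is definable. -/
def DefPred (L : FirstOrder.Language) [L.Structure ℝ] {α : Type} (p : (α → ℝ) → Prop) : Prop :=
  DefinableT L {v | p v}

/-- A real function of tuples of reals is definable, i.e. its graph is. -/
def DefFun (L : FirstOrder.Language) [L.Structure ℝ] {α : Type} (f : (α → ℝ) → ℝ) : Prop :=
  DefinableT L {v : Option α → ℝ | v none = f fun a => v (some a)}

namespace DefPred

theorem and {p q : (α → ℝ) → Prop} (hp : DefPred L p) (hq : DefPred L q) :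
    DefPred L fun v => p v ∧ q v :=
  Set.Definable.inter hp hq

theorem or {p q : (α → ℝ) → Prop} (hp : DefPred L p) (hq : DefPred L q) :
    DefPred L fun v => p v ∨ q v :=
  Set.Definable.union hp hq

theorem not {p : (α → ℝ) → Prop} (hp : DefPred L p) : DefPred L fun v => ¬ p v :=
  Set.Definable.compl hp

theorem congr {p q : (α → ℝ) → Prop} (hp : DefPred L p) (h : ∀ v, q v ↔ p v) :
    DefPred L q := by
  have : q = p := funext fun v => propext (h v)
  rwa [this]

theorem imp {p q : (α → ℝ) → Prop} (hp : DefPred L p) (hq : DefPred L q) :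
    DefPred L fun v => p v → q v :=
  (hp.not.or hq).congr fun _ => imp_iff_not_or

theorem forall_finite {ι : Type} [Finite ι] {p : ι → (α → ℝ) → Prop}
    (hp : ∀ i, DefPred L (p i)) : DefPred L fun v => ∀ i, p i v := by
  have := Set.definable_iInter_of_finite (A := univ) (L := L) hp
  unfold DefPred DefinableT
  convert this using 1
  ext v
  simp

theorem reindex (e : α → β) {p : (α → ℝ) → Prop} (hp : DefPred L p) :
    DefPred L fun w : β → ℝ => p fun a => w (e a) :=
  Set.Definable.preimage_comp e hp

theorem exists_block [Finite α] [Finite β] {p : (α → ℝ) → (β → ℝ) → Prop}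
    (hp : DefPred L fun w : α ⊕ β → ℝ => p (fun a => w (.inl a)) fun b => w (.inr b)) :
    DefPred L fun v => ∃ w, p v w := by
  have := Set.Definable.image_comp hp (Sum.inl : α → α ⊕ β)
  unfold DefPred DefinableT
  convert this using 1
  ext v
  constructor
  · rintro ⟨w, hw⟩
    exact ⟨Sum.elim v w, hw, rfl⟩
  · rintro ⟨u, hu, rfl⟩
    exact ⟨_, hu⟩

theorem exists_real [Finite α] {p : (α → ℝ) → ℝ → Prop}
    (hp : DefPred L fun w : Option α → ℝ => p (fun a => w (some a)) (w none)) :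
    DefPred L fun v => ∃ t, p v t := by
  have := Set.Definable.image_comp hp (some : α → Option α)
  unfold DefPred DefinableT
  convert this using 1
  ext v
  constructor
  · rintro ⟨t, ht⟩
    exact ⟨fun o => o.elim t v, ht, rfl⟩
  · rintro ⟨u, hu, rfl⟩
    exact ⟨_, hu⟩

theorem forall_block [Finite α] [Finite β] {p : (α → ℝ) → (β → ℝ) → Prop}
    (hp : DefPred L fun w : α ⊕ β → ℝ => p (fun a => w (.inl a)) fun b => w (.inr b)) :
    DefPred L fun v => ∀ w, p v w :=
  (exists_block (p := fun v w => ¬ p v w) hp.not).not.congr fun _ => by simp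

theorem forall_real [Finite α] {p : (α → ℝ) → ℝ → Prop}
    (hp : DefPred L fun w : Option α → ℝ => p (fun a => w (some a)) (w none)) :
    DefPred L fun v => ∀ t, p v t :=
  (exists_real (p := fun v t => ¬ p v t) hp.not).not.congr fun _ => by simp

theorem var_eq_var (a b : α) : DefPred L fun v : α → ℝ => v a = v b :=
  ⟨FirstOrder.Language.Term.equal (FirstOrder.Language.Term.var a)
    (FirstOrder.Language.Term.var b), by ext v; simp⟩

theorem var_eq_const (a : α) (c : ℝ) : DefPred L fun v : α → ℝ => v a = c :=
  ⟨FirstOrder.Language.Term.equal (FirstOrder.Language.Term.var a)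
    (FirstOrder.Language.Constants.term (L.con (⟨c, mem_univ c⟩ : (univ : Set ℝ)))), by
      ext v; simp⟩

theorem comp [Finite α] [Finite β] {p : (β → ℝ) → Prop} (hp : DefPred L p)
    {g : β → (α → ℝ) → ℝ} (hg : ∀ b, DefFun L (g b)) :
    DefPred L fun v => p fun b => g b v := by
  have key : DefPred L fun v : α → ℝ => ∃ w : β → ℝ, (∀ b, w b = g b v) ∧ p w := by
    refine exists_block (p := fun v w => (∀ b, w b = g b v) ∧ p w)
      (and (forall_finite fun b => ?_) (hp.reindex Sum.inr))
    exact reindex (fun o : Option α => o.elim (Sum.inr b) Sum.inl) (hg b)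
  refine key.congr fun v => ⟨fun h => ⟨_, fun _ => rfl, h⟩, ?_⟩
  rintro ⟨w, hw, h⟩
  rwa [← funext hw]

end DefPred

namespace DefFun

theorem var (a : α) : DefFun L fun v : α → ℝ => v a :=
  DefPred.var_eq_var none (some a)

theorem const (c : ℝ) : DefFun L fun _ : α → ℝ => c :=
  DefPred.var_eq_const none c

theorem reindex (e : α → β) {f : (α → ℝ) → ℝ} (hf : DefFun L f) :
    DefFun L fun w : β → ℝ => f fun a => w (e a) :=
  DefPred.reindex (Option.map e) hf

theorem comp [Finite α] [Finite β] {f : (β → ℝ) → ℝ} (hf : DefFun L f)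
    {g : β → (α → ℝ) → ℝ} (hg : ∀ b, DefFun L (g b)) :
    DefFun L fun v => f fun b => g b v := by
  refine DefPred.comp (p := fun w : Option β → ℝ => w none = f fun b => w (some b)) hf
    (g := fun o v => o.elim (v none) fun b => g b fun a => v (some a)) ?_
  rintro (_ | b)
  · exact var none
  · exact (hg b).reindex some

theorem add (hL : IsOMinimalOn L) [Finite α] {f g : (α → ℝ) → ℝ} (hf : DefFun L f)
    (hg : DefFun L g) : DefFun L fun v => f v + g v := by
  refine DefPred.comp (p := fun v : Fin 3 → ℝ => v 2 = v 0 + v 1) hL.definable_add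
    (g := ![fun v => f fun a => v (some a), fun v => g fun a => v (some a), fun v => v none]) ?_
  intro b
  fin_cases b
  · exact hf.reindex some
  · exact hg.reindex some
  · exact var none

theorem mul (hL : IsOMinimalOn L) [Finite α] {f g : (α → ℝ) → ℝ} (hf : DefFun L f)
    (hg : DefFun L g) : DefFun L fun v => f v * g v := by
  refine DefPred.comp (p := fun v : Fin 3 → ℝ => v 2 = v 0 * v 1) hL.definable_mul
    (g := ![fun v => f fun a => v (some a), fun v => g fun a => v (some a), fun v => v none]) ?_
  intro b
  fin_cases b
  · exact hf.reindex some
  · exact hg.reindex some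
  · exact var none

theorem sub (hL : IsOMinimalOn L) [Finite α] {f g : (α → ℝ) → ℝ} (hf : DefFun L f)
    (hg : DefFun L g) : DefFun L fun v => f v - g v := by
  have := hf.add hL ((const (-1)).mul hL hg)
  simpa [sub_eq_add_neg] using this

theorem sum (hL : IsOMinimalOn L) [Finite α] {ι : Type} (s : Finset ι) {f : ι → (α → ℝ) → ℝ}
    (hf : ∀ i, DefFun L (f i)) : DefFun L fun v => ∑ i ∈ s, f i v := by
  classical
  induction s using Finset.induction_on with
  | empty => simpa using const 0
  | insert a s ha ih => simpa [Finset.sum_insert ha] using (hf a).add hL ih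

theorem lt (hL : IsOMinimalOn L) [Finite α] {f g : (α → ℝ) → ℝ} (hf : DefFun L f)
    (hg : DefFun L g) : DefPred L fun v => f v < g v := by
  refine DefPred.comp (p := fun v : Fin 2 → ℝ => v 0 < v 1) hL.definable_lt (g := ![f, g]) ?_
  intro b
  fin_cases b
  · exact hf
  · exact hg

theorem le (hL : IsOMinimalOn L) [Finite α] {f g : (α → ℝ) → ℝ} (hf : DefFun L f)
    (hg : DefFun L g) : DefPred L fun v => f v ≤ g v :=
  (hg.lt hL hf).not.congr fun _ => not_lt.symm

theorem abs_le (hL : IsOMinimalOn L) [Finite α] {f g : (α → ℝ) → ℝ} (hf : DefFun L f)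
    (hg : DefFun L g) : DefPred L fun v => |f v| ≤ g v := by
  refine ((((const 0).sub hL hg).le hL hf).and (hf.le hL hg)).congr fun v => ?_
  rw [_root_.abs_le, zero_sub]

theorem update [DecidableEq β] {X : (α → ℝ) → β → ℝ} (hX : ∀ b, DefFun L fun v => X v b)
    (j : β) {T : (α → ℝ) → ℝ} (hT : DefFun L T) (b : β) :
    DefFun L fun v => Function.update (X v) j (T v) b := by
  by_cases h : b = j
  · subst h
    simpa using hT
  · simpa [Function.update_of_ne h] using hX b

end DefFun

end DefinabilityCalculus

/-- The property `p` holds on some interval `(0, r)` with `r > 0`. -/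
def HoldsNearZero (p : ℝ → Prop) : Prop := ∃ r > (0 : ℝ), ∀ t, 0 < t → t < r → p t

theorem holdsNearZero_iff_eventually {p : ℝ → Prop} :
    HoldsNearZero p ↔ ∀ᶠ t in 𝓝[>] (0 : ℝ), p t := by
  rw [Filter.Eventually, mem_nhdsGT_iff_exists_Ioo_subset]
  exact ⟨fun ⟨r, hr, h⟩ => ⟨r, hr, fun t ht => h t ht.1 ht.2⟩,
    fun ⟨r, hr, h⟩ => ⟨r, hr, fun t h0 h1 => h ⟨h0, h1⟩⟩⟩

theorem DefPred.holdsNearZero {L : FirstOrder.Language} [L.Structure ℝ] (hL : IsOMinimalOn L)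
    {α : Type} [Finite α] {p : (α → ℝ) → ℝ → Prop}
    (hp : DefPred L fun w : Option α → ℝ => p (fun a => w (some a)) (w none)) :
    DefPred L fun v => HoldsNearZero (p v) := by
  refine exists_real (p := fun v r => r > 0 ∧ ∀ t, 0 < t → t < r → p v t)
    (((DefFun.const 0).lt hL (DefFun.var none)).and ?_)
  refine forall_real (p := fun v t => 0 < t → t < v none → p (fun a => v (some a)) t)
    (((DefFun.const 0).lt hL (DefFun.var none)).imp
      (((DefFun.var none).lt hL (DefFun.var (some none))).imp ?_))
  exact hp.reindex (fun o : Option α => o.elim none fun a => some (some a))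

theorem eventually_mem_or_eventually_notMem_interval (a b : EReal) :
    (∀ᶠ t : ℝ in 𝓝[>] 0, a < (t : EReal) ∧ (t : EReal) < b) ∨
      ∀ᶠ t : ℝ in 𝓝[>] 0, ¬ (a < (t : EReal) ∧ (t : EReal) < b) := by
  have hpos : ∀ᶠ t : ℝ in 𝓝[>] 0, (0 : EReal) < t := by
    filter_upwards [self_mem_nhdsWithin] with t ht
    exact_mod_cast ht
  have hlt : ∀ c : EReal, 0 < c → ∀ᶠ t : ℝ in 𝓝[>] 0, (t : EReal) < c := fun c hc =>
    nhdsWithin_le_nhds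
      ((continuous_coe_real_ereal.tendsto 0).eventually_lt_const (by simpa using hc))
  rcases le_or_gt a 0 with ha | ha
  · rcases lt_or_ge 0 b with hb | hb
    · left
      filter_upwards [hpos, hlt b hb] with t h0 h1
      exact ⟨ha.trans_lt h0, h1⟩
    · right
      filter_upwards [hpos] with t h0 h
      exact absurd (h.2.trans_le hb) h0.not_gt
  · right
    filter_upwards [hlt a ha] with t h0 h
    exact h0.not_gt h.1

theorem holdsNearZero_or_not {L : FirstOrder.Language} [L.Structure ℝ] (hL : IsOMinimalOn L)
    {p : ℝ → Prop} (hp : DefPred L fun v : Fin 1 → ℝ => p (v 0)) :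
    HoldsNearZero p ∨ HoldsNearZero fun t => ¬ p t := by
  simp only [holdsNearZero_iff_eventually]
  obtain ⟨P, I, hPI⟩ := hL.finite_union {t | p t} hp
  have hmem : ∀ t, p t ↔ t ∈ P ∨ ∃ q ∈ I, q.1 < (t : EReal) ∧ (t : EReal) < q.2 := fun t => by
    have := Set.ext_iff.1 hPI t
    simpa only [mem_ofPred_eq, mem_union, Finset.mem_coe, mem_iUnion₂, exists_prop] using this
  by_cases h : ∃ q ∈ I, ∀ᶠ t : ℝ in 𝓝[>] 0, q.1 < (t : EReal) ∧ (t : EReal) < q.2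
  · obtain ⟨q, hq, h⟩ := h
    left
    filter_upwards [h] with t ht
    exact (hmem t).2 (Or.inr ⟨q, hq, ht⟩)
  · right
    have hI : ∀ᶠ t : ℝ in 𝓝[>] 0, ∀ q ∈ I, ¬ (q.1 < (t : EReal) ∧ (t : EReal) < q.2) := by
      rw [Filter.eventually_all_finset]
      intro q hq
      exact (eventually_mem_or_eventually_notMem_interval q.1 q.2).resolve_left
        fun hh => h ⟨q, hq, hh⟩
    have hP : ∀ᶠ t : ℝ in 𝓝[>] 0, t ∉ P := by
      have h1 : 𝓝[>] (0 : ℝ) ≤ cofinite :=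
        (nhdsWithin_mono _ fun t ht => ne_of_gt ht).trans (nhdsNE_le_cofinite 0)
      exact h1 P.finite_toSet.compl_mem_cofinite
    filter_upwards [hI, hP] with t h1 h2 h3
    rcases (hmem t).1 h3 with h4 | ⟨q, hq, h4⟩
    · exact h2 h4
    · exact h1 q hq h4

/-- A nonempty open subset of `ℝ` contains a nondegenerate interval with rational endpoints. -/
theorem exists_rat_Ioo_subset {U : Set ℝ} (hU : IsOpen U) {x : ℝ} (hx : x ∈ U) :
    ∃ p q : ℚ, p < q ∧ Icc (p : ℝ) q ⊆ U := by
  obtain ⟨r, hr, h⟩ := Metric.isOpen_iff.1 hU x hx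
  obtain ⟨p, hp1, hp2⟩ := exists_rat_btwn (show x - r < x by linarith)
  obtain ⟨q, hq1, hq2⟩ := exists_rat_btwn (show x < x + r by linarith)
  refine ⟨p, q, by exact_mod_cast hp2.trans hq1, fun t ht => h ?_⟩
  rw [Real.ball_eq_Ioo]
  exact ⟨hp1.trans_le ht.1, ht.2.trans_lt hq2⟩

theorem exists_rat_Ioo_of_countable_cover {L : FirstOrder.Language} [L.Structure ℝ]
    (hL : IsOMinimalOn L) {ι : Type} [Countable ι] {A : ι → ℝ → Prop}
    (hA : ∀ k, DefPred L fun v : Fin 1 → ℝ => A k (v 0)) {a b : ℝ} (hab : a < b)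
    (hcov : ∀ t, a < t → t < b → ∃ k, A k t) :
    ∃ k, ∃ p q : ℚ, a < p ∧ p < q ∧ (q : ℝ) < b ∧ ∀ t : ℝ, p < t → t < q → A k t := by
  by_contra! hno
  have hcount : ∀ k, ({t | A k t} ∩ Ioo a b).Countable := by
    intro k
    obtain ⟨P, I, hPI⟩ := hL.finite_union {t | A k t} (hA k)
    refine P.countable_toSet.mono ?_
    rintro x ⟨hx, hxab⟩
    rw [hPI] at hx
    refine hx.resolve_right fun hxI => ?_
    obtain ⟨J, hJ, hxJ⟩ := mem_iUnion₂.1 hxI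
    have hopen : IsOpen ({x : ℝ | J.1 < (x : EReal) ∧ (x : EReal) < J.2} ∩ Ioo a b) :=
      (isOpen_Ioo.preimage continuous_coe_real_ereal).inter isOpen_Ioo
    obtain ⟨p, q, hpq, hsub⟩ := exists_rat_Ioo_subset hopen ⟨hxJ, hxab⟩
    have hpq' : (p : ℝ) ≤ q := by exact_mod_cast hpq.le
    obtain ⟨t, ht1, ht2, ht⟩ := hno k p q (hsub ⟨le_rfl, hpq'⟩).2.1 hpq (hsub ⟨hpq', le_rfl⟩).2.2
    apply ht
    change t ∈ {t | A k t}
    rw [hPI]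
    exact Or.inr (mem_iUnion₂.2 ⟨J, hJ, (hsub ⟨ht1.le, ht2.le⟩).1⟩)
  have := (countable_iUnion hcount).mono (s₁ := Ioo a b) fun t ht => by
    obtain ⟨k, hk⟩ := hcov t ht.1 ht.2
    exact mem_iUnion.2 ⟨k, hk, ht⟩
  exact absurd (Cardinal.Real.Ioo_countable_iff.1 this) (not_le.2 hab)

/-- The open box with opposite corners `a` and `b`. -/
def openBox {n : ℕ} (a b : Fin n → ℝ) : Set (Fin n → ℝ) := {x | ∀ i, a i < x i ∧ x i < b i}

theorem isOpen_openBox {n : ℕ} (a b : Fin n → ℝ) : IsOpen (openBox a b) := by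
  have : openBox a b = Set.pi univ fun i => Ioo (a i) (b i) := by
    ext x
    simp [openBox]
  rw [this]
  exact isOpen_set_pi finite_univ fun i _ => isOpen_Ioo

theorem openBox_nonempty {n : ℕ} {a b : Fin n → ℝ} (hab : ∀ i, a i < b i) :
    (openBox a b).Nonempty :=
  ⟨fun i => (a i + b i) / 2, fun i => by
    have := hab i
    constructor <;> linarith⟩

/-- If countably many definable sets cover an open box, then one of them contains an open
box. -/
theorem exists_openBox_of_countable_cover {L : FirstOrder.Language} [L.Structure ℝ]
    (hL : IsOMinimalOn L) {n : ℕ} {ι : Type} [Countable ι] {A : ι → (Fin n → ℝ) → Prop}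
    (hA : ∀ k, DefPred L (A k)) {a b : Fin n → ℝ} (hab : ∀ i, a i < b i)
    (hcov : ∀ x ∈ openBox a b, ∃ k, A k x) :
    ∃ k, ∃ a' b' : Fin n → ℝ, (∀ i, a' i < b' i) ∧ openBox a' b' ⊆ openBox a b ∧
      ∀ x ∈ openBox a' b', A k x := by
  induction n generalizing ι with
  | zero =>
    obtain ⟨k, hk⟩ := hcov a fun i => i.elim0
    exact ⟨k, a, b, hab, subset_rfl, fun x _ => by rwa [Subsingleton.elim x a]⟩
  | succ n ih =>
    let κ : Type := {r : ι × ℚ × ℚ // a 0 < r.2.1 ∧ r.2.1 < r.2.2 ∧ (r.2.2 : ℝ) < b 0}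
    have hdef : ∀ r : κ, DefPred L fun x : Fin n → ℝ =>
        ∀ t : ℝ, r.1.2.1 < t → t < r.1.2.2 → A r.1.1 (Fin.cons t x) := by
      intro r
      refine DefPred.forall_real (p := fun (x : Fin n → ℝ) t =>
        (r.1.2.1 : ℝ) < t → t < r.1.2.2 → A r.1.1 (Fin.cons t x))
        (((DefFun.const _).lt hL (DefFun.var none)).imp
          (((DefFun.var none).lt hL (DefFun.const _)).imp ?_))
      refine DefPred.comp (hA r.1.1) (g := fun i (w : Option (Fin n) → ℝ) =>
        (Fin.cons (w none) (fun a => w (some a)) : Fin (n + 1) → ℝ) i) fun i => ?_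
      refine Fin.cases ?_ (fun j => ?_) i
      · exact DefFun.var none
      · exact DefFun.var (some j)
    obtain ⟨⟨⟨k, p, q⟩, hap, hpq, hqb⟩, a', b', hab', hsub, h⟩ :=
      ih hdef (a := fun i => a i.succ) (b := fun i => b i.succ) (fun i => hab _) (by
        intro x hx
        obtain ⟨k, p, q, h1, h2, h3, h4⟩ := exists_rat_Ioo_of_countable_cover hL
          (A := fun k t => A k (Fin.cons t x)) (fun k => DefPred.comp (hA k)
            (g := fun i (w : Fin 1 → ℝ) => (Fin.cons (w 0) x : Fin (n + 1) → ℝ) i) fun i => by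
              refine Fin.cases ?_ (fun j => ?_) i
              · exact DefFun.var 0
              · exact DefFun.const (x j)) (hab 0)
          (fun t h1 h2 => hcov _ fun i => by
            refine Fin.cases ⟨h1, h2⟩ (fun j => ?_) i
            simpa using hx j)
        exact ⟨⟨⟨k, p, q⟩, h1, h2, h3⟩, h4⟩)
    dsimp only at hap hpq hqb h
    refine ⟨k, Fin.cons p a', Fin.cons q b', ?_, ?_, ?_⟩
    · intro i
      refine Fin.cases ?_ (fun j => ?_) i
      · simpa using hpq
      · simpa using hab' j
    · intro x hx i
      refine Fin.cases ?_ (fun j => ?_) i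
      · exact ⟨hap.trans (hx 0).1, (hx 0).2.trans hqb⟩
      · exact hsub (a := fun j => x j.succ) (fun j => hx j.succ) j
    · intro x hx
      have := h (fun j => x j.succ) (fun j => hx j.succ) (x 0) (hx 0).1 (hx 0).2
      rwa [show (Fin.cons (x 0) fun j => x (Fin.succ j) : Fin (n + 1) → ℝ) = x from
        Fin.cons_self_tail x] at this

section Increments

variable {L : FirstOrder.Language} [L.Structure ℝ] {n : ℕ}

/-- Near `x`, moving forward along the `j`-th axis increases `g` with slope at least `c`. -/
def RightSteep (c : ℝ) (g : (Fin n → ℝ) → ℝ) (j : Fin n) (x : Fin n → ℝ) : Prop :=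
  HoldsNearZero fun t => c * t ≤ g (Function.update x j (x j + t)) - g x

/-- Near `x`, moving backward along the `j`-th axis decreases `g` with slope at least `c`. -/
def LeftSteep (c : ℝ) (g : (Fin n → ℝ) → ℝ) (j : Fin n) (x : Fin n → ℝ) : Prop :=
  HoldsNearZero fun t => c * t ≤ g x - g (Function.update x j (x j - t))

/-- A definable function of `n + 1` variables, evaluated at definable arguments. -/
theorem DefFun.app {α : Type} [Finite α] {G : (Fin n → ℝ) → ℝ → ℝ}
    (hG : DefFun L fun w : Fin n ⊕ Fin 1 → ℝ => G (fun j => w (.inl j)) (w (.inr 0)))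
    {X : (α → ℝ) → Fin n → ℝ} (hX : ∀ j, DefFun L fun v => X v j) {S : (α → ℝ) → ℝ}
    (hS : DefFun L S) : DefFun L fun v => G (X v) (S v) := by
  refine DefFun.comp hG (g := fun b v => Sum.elim (X v) (fun _ => S v) b) ?_
  rintro (j | _)
  · exact hX j
  · exact hS

theorem DefPred.rightSteep (hL : IsOMinimalOn L) {α : Type} [Finite α]
    {G : (Fin n → ℝ) → ℝ → ℝ}
    (hG : DefFun L fun w : Fin n ⊕ Fin 1 → ℝ => G (fun j => w (.inl j)) (w (.inr 0)))
    (c : ℝ) (j : Fin n) {X : (α → ℝ) → Fin n → ℝ} (hX : ∀ j, DefFun L fun v => X v j)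
    {S : (α → ℝ) → ℝ} (hS : DefFun L S) :
    DefPred L fun v => RightSteep c (fun x => G x (S v)) j (X v) := by
  refine DefPred.holdsNearZero hL (p := fun v t =>
    c * t ≤ G (Function.update (X v) j (X v j + t)) (S v) - G (X v) (S v)) ?_
  have hX' := fun j => (hX j).reindex (some : α → Option α)
  have hS' := hS.reindex (some : α → Option α)
  exact ((DefFun.const c).mul hL (DefFun.var none)).le hL
    ((DefFun.app hG (DefFun.update hX' j ((hX' j).add hL (DefFun.var none))) hS').sub hL
      (DefFun.app hG hX' hS'))

theorem DefPred.leftSteep (hL : IsOMinimalOn L) {α : Type} [Finite α]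
    {G : (Fin n → ℝ) → ℝ → ℝ}
    (hG : DefFun L fun w : Fin n ⊕ Fin 1 → ℝ => G (fun j => w (.inl j)) (w (.inr 0)))
    (c : ℝ) (j : Fin n) {X : (α → ℝ) → Fin n → ℝ} (hX : ∀ j, DefFun L fun v => X v j)
    {S : (α → ℝ) → ℝ} (hS : DefFun L S) :
    DefPred L fun v => LeftSteep c (fun x => G x (S v)) j (X v) := by
  refine DefPred.holdsNearZero hL (p := fun v t =>
    c * t ≤ G (X v) (S v) - G (Function.update (X v) j (X v j - t)) (S v)) ?_
  have hX' := fun j => (hX j).reindex (some : α → Option α)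
  have hS' := hS.reindex (some : α → Option α)
  exact ((DefFun.const c).mul hL (DefFun.var none)).le hL
    ((DefFun.app hG hX' hS').sub hL
      (DefFun.app hG (DefFun.update hX' j ((hX' j).sub hL (DefFun.var none))) hS'))

theorem DefFun.app_of_defFun {α : Type} [Finite α] {g : (Fin n → ℝ) → ℝ} (hg : DefFun L g)
    {X : (α → ℝ) → Fin n → ℝ} (hX : ∀ j, DefFun L fun v => X v j) :
    DefFun L fun v => g (X v) :=
  DefFun.comp hg (g := fun j v => X v j) hX

/-- The set of points of differentiability of a definable function is definable. -/
theorem DefFun.differentiableAt (hL : IsOMinimalOn L) {g : (Fin n → ℝ) → ℝ}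
    (hg : DefFun L g) : DefPred L fun x => DifferentiableAt ℝ g x := by
  have key : DefPred L fun x : Fin n → ℝ => ∃ u : Fin n → ℝ, ∀ e, 0 < e → ∃ d, 0 < d ∧
      ∀ r, 0 ≤ r → r < d → ∀ y : Fin n → ℝ, (∀ j, |y j - x j| ≤ r) →
        |g y - g x - ∑ j, u j * (y j - x j)| ≤ e * r := by
    refine DefPred.exists_block (p := fun (x u : Fin n → ℝ) => ∀ e, 0 < e → ∃ d, 0 < d ∧
      ∀ r, 0 ≤ r → r < d → ∀ y : Fin n → ℝ, (∀ j, |y j - x j| ≤ r) →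
        |g y - g x - ∑ j, u j * (y j - x j)| ≤ e * r) ?_
    refine DefPred.forall_real (p := fun (w : Fin n ⊕ Fin n → ℝ) e => 0 < e → ∃ d, 0 < d ∧
      ∀ r, 0 ≤ r → r < d → ∀ y : Fin n → ℝ, (∀ j, |y j - w (.inl j)| ≤ r) →
        |g y - g (fun j => w (.inl j)) - ∑ j, w (.inr j) * (y j - w (.inl j))| ≤ e * r) ?_
    refine DefPred.imp ((DefFun.const 0).lt hL (DefFun.var none)) ?_
    refine DefPred.exists_real (p := fun (w : Option (Fin n ⊕ Fin n) → ℝ) d => 0 < d ∧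
      ∀ r, 0 ≤ r → r < d → ∀ y : Fin n → ℝ, (∀ j, |y j - w (some (.inl j))| ≤ r) →
        |g y - g (fun j => w (some (.inl j))) -
          ∑ j, w (some (.inr j)) * (y j - w (some (.inl j)))| ≤ w none * r) ?_
    refine DefPred.and ((DefFun.const 0).lt hL (DefFun.var none)) ?_
    refine DefPred.forall_real (p := fun (w : Option (Option (Fin n ⊕ Fin n)) → ℝ) r =>
      0 ≤ r → r < w none → ∀ y : Fin n → ℝ, (∀ j, |y j - w (some (some (.inl j)))| ≤ r) →
        |g y - g (fun j => w (some (some (.inl j)))) -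
          ∑ j, w (some (some (.inr j))) * (y j - w (some (some (.inl j))))| ≤
            w (some none) * r) ?_
    refine DefPred.imp ((DefFun.const 0).le hL (DefFun.var none)) ?_
    refine DefPred.imp ((DefFun.var none).lt hL (DefFun.var _)) ?_
    refine DefPred.forall_block (p := fun (w : Option (Option (Option (Fin n ⊕ Fin n))) → ℝ)
      (y : Fin n → ℝ) => (∀ j, |y j - w (some (some (some (.inl j))))| ≤ w none) →
        |g y - g (fun j => w (some (some (some (.inl j))))) -
          ∑ j, w (some (some (some (.inr j)))) * (y j - w (some (some (some (.inl j)))))| ≤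
            w (some (some none)) * w none) ?_
    refine DefPred.imp (DefPred.forall_finite fun j => DefFun.abs_le hL
      ((DefFun.var _).sub hL (DefFun.var _)) (DefFun.var _)) ?_
    refine DefFun.abs_le hL (((hg.app_of_defFun fun j => DefFun.var _).sub hL
      (hg.app_of_defFun fun j => DefFun.var _)).sub hL (DefFun.sum hL _ fun j =>
        (DefFun.var _).mul hL ((DefFun.var _).sub hL (DefFun.var _))))
      ((DefFun.var _).mul hL (DefFun.var _))
  refine key.congr fun x => ⟨?_, ?_⟩
  · rintro ⟨D, hD⟩
    refine ⟨fun j => D (Pi.single j 1), fun e he => ?_⟩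
    rw [hasFDerivAt_iff_isLittleO, Asymptotics.isLittleO_iff] at hD
    obtain ⟨d, hd, h⟩ := Metric.eventually_nhds_iff.1 (hD he)
    refine ⟨d, hd, fun r hr hrd y hy => ?_⟩
    have hnorm : ‖y - x‖ ≤ r := (pi_norm_le_iff_of_nonneg hr).2 fun j => hy j
    have := h (y := y) (by rw [dist_eq_norm]; exact hnorm.trans_lt hrd)
    have hsum : D (y - x) = ∑ j, D (Pi.single j 1) * (y j - x j) := by
      conv_lhs => rw [pi_eq_sum_univ' (y - x)]
      simp [mul_comm]
    rw [← hsum]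
    exact this.trans (mul_le_mul_of_nonneg_left hnorm he.le)
  · rintro ⟨u, hu⟩
    refine ⟨∑ j, u j • ContinuousLinearMap.proj (R := ℝ) (φ := fun _ : Fin n => ℝ) j, ?_⟩
    rw [hasFDerivAt_iff_isLittleO, Asymptotics.isLittleO_iff]
    intro e he
    obtain ⟨d, hd, h⟩ := hu e he
    refine Metric.eventually_nhds_iff.2 ⟨d, hd, fun y hy => ?_⟩
    rw [dist_eq_norm] at hy
    have := h _ (norm_nonneg _) hy y fun j => norm_le_pi_norm (y - x) j
    simpa [Real.norm_eq_abs] using this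

/-- A function that is steep on both sides of each point of an interval is steep throughout. -/
theorem mul_sub_le_of_locally_steep {h : ℝ → ℝ} {c a b : ℝ}
    (hr : ∀ x, a ≤ x → x ≤ b → HoldsNearZero fun t => c * t ≤ h (x + t) - h x)
    (hl : ∀ x, a ≤ x → x ≤ b → HoldsNearZero fun t => c * t ≤ h x - h (x - t))
    (hab : a ≤ b) : c * (b - a) ≤ h b - h a := by
  set S : Set ℝ := {z | a ≤ z ∧ z ≤ b ∧ c * (z - a) ≤ h z - h a} with hS
  have haS : a ∈ S := ⟨le_rfl, hab, by simp⟩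
  have hbdd : BddAbove S := ⟨b, fun z hz => hz.2.1⟩
  set z := sSup S with hz
  have haz : a ≤ z := le_csSup hbdd haS
  have hzb : z ≤ b := csSup_le ⟨a, haS⟩ fun w hw => hw.2.1
  have hzS : c * (z - a) ≤ h z - h a := by
    obtain ⟨r, hr0, hr⟩ := hl z haz hzb
    obtain ⟨w, hw, hzw⟩ := exists_lt_of_lt_csSup ⟨a, haS⟩ (show z - r < sSup S by linarith)
    rcases (le_csSup hbdd hw).lt_or_eq with hlt | heq
    · have h1 : c * (z - w) ≤ h z - h (z - (z - w)) := hr _ (by linarith) (by linarith)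
      rw [sub_sub_cancel] at h1
      have h2 := hw.2.2
      linarith
    · have := hw.2.2
      rwa [heq] at this
  rcases hzb.lt_or_eq with hlt | heq
  · exfalso
    obtain ⟨r, hr0, hr⟩ := hr z haz hzb
    set t := min (r / 2) (b - z) with ht
    have ht0 : 0 < t := lt_min (by linarith) (by linarith)
    have htr : t < r := (min_le_left _ _).trans_lt (by linarith)
    have htb : t ≤ b - z := min_le_right _ _
    have h1 : c * t ≤ h (z + t) - h z := hr t ht0 htr
    have : z + t ≤ z := le_csSup hbdd ⟨by linarith, by linarith, by linarith⟩
    linarith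
  · rwa [heq] at hzS

theorem update_mem_openBox {a b x : Fin n → ℝ} (hx : x ∈ openBox a b) {j : Fin n} {τ : ℝ}
    (h1 : a j < τ) (h2 : τ < b j) : Function.update x j τ ∈ openBox a b := by
  intro i
  by_cases h : i = j
  · subst h
    simpa using ⟨h1, h2⟩
  · simpa [Function.update_of_ne h] using hx i

theorem HoldsNearZero.exists_nat {p : ℝ → Prop} (h : HoldsNearZero p) :
    ∃ l : ℕ, ∀ t, 0 < t → t < 1 / ((l : ℝ) + 1) → p t := by
  obtain ⟨r, hr, h⟩ := h
  obtain ⟨l, hl⟩ := exists_nat_one_div_lt hr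
  exact ⟨l, fun t h0 h1 => h t h0 (h1.trans hl)⟩

/-- A definable function cannot be right steep but nowhere left steep on an open box. -/
theorem exists_leftSteep_of_rightSteep (hL : IsOMinimalOn L) {g : (Fin n → ℝ) → ℝ}
    (hg : DefFun L g) {c : ℝ} {j : Fin n} {a b : Fin n → ℝ} (hab : ∀ i, a i < b i)
    (hR : ∀ x ∈ openBox a b, RightSteep c g j x) : ∃ x ∈ openBox a b, LeftSteep c g j x := by
  obtain ⟨l, a', b', hab', hsub, h⟩ := exists_openBox_of_countable_cover hL
    (A := fun (l : ℕ) x => ∀ t, 0 < t → t < 1 / ((l : ℝ) + 1) →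
      c * t ≤ g (Function.update x j (x j + t)) - g x) (fun l => by
        refine DefPred.forall_real (p := fun (x : Fin n → ℝ) t => 0 < t → t < 1 / ((l : ℝ) + 1) →
          c * t ≤ g (Function.update x j (x j + t)) - g x) ?_
        refine DefPred.imp ((DefFun.const 0).lt hL (DefFun.var none)) ?_
        refine DefPred.imp ((DefFun.var none).lt hL (DefFun.const _)) ?_
        exact ((DefFun.const c).mul hL (DefFun.var none)).le hL
          ((hg.app_of_defFun (DefFun.update (fun j => DefFun.var (some j)) j
            ((DefFun.var (some j)).add hL (DefFun.var none)))).sub hL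
              (hg.app_of_defFun fun j => DefFun.var (some j)))) hab
    (fun x hx => (hR x hx).exists_nat)
  obtain ⟨x, hx⟩ := openBox_nonempty hab'
  have hl : (0 : ℝ) < 1 / ((l : ℝ) + 1) := by positivity
  refine ⟨x, hsub hx, min (1 / ((l : ℝ) + 1)) (x j - a' j),
    lt_min hl (by linarith [(hx j).1]), fun t h0 h1 => ?_⟩
  obtain ⟨h1, h2⟩ := lt_min_iff.1 h1
  have := h _ (update_mem_openBox hx (j := j) (τ := x j - t) (by linarith)
    (by linarith [(hx j).2])) t h0 h1
  simpa using this

/-- A bound on the increments along each axis gives a Lipschitz bound. -/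
theorem abs_sub_le_of_update {g : (Fin n → ℝ) → ℝ} {c : ℝ} (hc : 0 ≤ c) {a b : Fin n → ℝ}
    (h : ∀ x ∈ openBox a b, ∀ j τ, a j < τ → τ < b j →
      |g (Function.update x j τ) - g x| ≤ c * |τ - x j|)
    {x y : Fin n → ℝ} (hx : x ∈ openBox a b) (hy : y ∈ openBox a b) :
    |g y - g x| ≤ n * c * ‖y - x‖ := by
  have key : ∀ s : Finset (Fin n), s.piecewise y x ∈ openBox a b ∧
      |g (s.piecewise y x) - g x| ≤ s.card * c * ‖y - x‖ := by
    intro s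
    induction s using Finset.induction_on with
    | empty => simpa using hx
    | insert j s hj ih =>
      have hj1 := h _ ih.1 j (y j) (hy j).1 (hy j).2
      rw [Finset.piecewise_eq_of_notMem _ _ _ hj] at hj1
      rw [Finset.piecewise_insert, Finset.card_insert_of_notMem hj]
      refine ⟨update_mem_openBox ih.1 (hy j).1 (hy j).2, ?_⟩
      have h2 : c * |y j - x j| ≤ c * ‖y - x‖ :=
        mul_le_mul_of_nonneg_left (norm_le_pi_norm (y - x) j) hc
      have h3 := abs_sub_le (g (Function.update (s.piecewise y x) j (y j)))
        (g (s.piecewise y x)) (g x)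
      push_cast
      linarith [ih.2]
  simpa using (key Finset.univ).2

/-- A definable function that is Lipschitz along the axes of an open box is differentiable on
a smaller open box. -/
theorem exists_openBox_differentiableAt (hL : IsOMinimalOn L) {m : ℕ}
    {f : Fin m → (Fin n → ℝ) → ℝ} (hf : ∀ i, DefFun L (f i)) {c : ℝ} (hc : 0 ≤ c)
    {a b : Fin n → ℝ} (hab : ∀ i, a i < b i)
    (h : ∀ i, ∀ x ∈ openBox a b, ∀ j τ, a j < τ → τ < b j →
      |f i (Function.update x j τ) - f i x| ≤ c * |τ - x j|) :
    ∃ a' b' : Fin n → ℝ, (∀ i, a' i < b' i) ∧ openBox a' b' ⊆ openBox a b ∧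
      ∀ x ∈ openBox a' b', ∀ i, DifferentiableAt ℝ (f i) x := by
  have hdef : DefPred L fun x => ∀ i, DifferentiableAt ℝ (f i) x :=
    DefPred.forall_finite fun i => (hf i).differentiableAt hL
  obtain ⟨k, a', b', hab', hsub, hk⟩ := exists_openBox_of_countable_cover hL
    (A := fun (k : Bool) x => if k then ∀ i, DifferentiableAt ℝ (f i) x
      else ¬ ∀ i, DifferentiableAt ℝ (f i) x) (fun k => by
        cases k
        · simpa using hdef.not
        · simpa using hdef) hab (fun x _ => by
          by_cases hx : ∀ i, DifferentiableAt ℝ (f i) x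
          · exact ⟨true, by simpa using hx⟩
          · exact ⟨false, by simpa using hx⟩)
  refine ⟨a', b', hab', hsub, ?_⟩
  cases k
  · exfalso
    have hae : ∀ᵐ x : Fin n → ℝ, x ∈ openBox a b → ∀ i, DifferentiableAt ℝ (f i) x := by
      have : ∀ᵐ x : Fin n → ℝ, ∀ i, x ∈ openBox a b →
          DifferentiableWithinAt ℝ (f i) (openBox a b) x := by
        rw [MeasureTheory.ae_all_iff]
        intro i
        have hlip : LipschitzOnWith (n * c).toNNReal (f i) (openBox a b) := by
          refine LipschitzOnWith.of_dist_le_mul fun y hy x hx => ?_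
          rw [Real.coe_toNNReal _ (by positivity), dist_eq_norm, Real.norm_eq_abs, dist_eq_norm]
          exact abs_sub_le_of_update hc (h i) hx hy
        exact hlip.ae_differentiableWithinAt_of_mem
      filter_upwards [this] with x hx hxab i
      exact (hx i hxab).differentiableAt ((isOpen_openBox a b).mem_nhds hxab)
    have hzero : MeasureTheory.volume (openBox a' b') = 0 := by
      refine MeasureTheory.measure_mono_null ?_ (MeasureTheory.ae_iff.1 hae)
      intro x hx
      simpa using ⟨hsub hx, by simpa using hk x hx⟩
    exact (isOpen_openBox a' b').measure_ne_zero _ (openBox_nonempty hab') hzero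
  · simpa using hk

/-- A definable map whose right difference quotients along the axes are small is differentiable
with small partial derivatives on some open box. -/
theorem exists_openBox_deriv_le (hL : IsOMinimalOn L) {m : ℕ}
    {f : Fin m → (Fin n → ℝ) → ℝ} (hf : ∀ i, DefFun L (f i)) {c : ℝ} (hc : 0 ≤ c)
    {a b : Fin n → ℝ} (hab : ∀ i, a i < b i)
    (h : ∀ x ∈ openBox a b, ∀ i j, HoldsNearZero fun t =>
      |f i (Function.update x j (x j + t)) - f i x| ≤ c * t) :
    ∃ a' b' : Fin n → ℝ, (∀ i, a' i < b' i) ∧ openBox a' b' ⊆ openBox a b ∧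
      ∀ x ∈ openBox a' b', ∀ i, DifferentiableAt ℝ (f i) x ∧
        ∀ j, |deriv (fun τ => f i (Function.update x j τ)) (x j)| ≤ c := by
  obtain ⟨l, a₁, b₁, hab₁, hsub₁, h₁⟩ := exists_openBox_of_countable_cover hL
    (A := fun (l : ℕ) x => ∀ t, 0 < t → t < 1 / ((l : ℝ) + 1) →
      ∀ i j, |f i (Function.update x j (x j + t)) - f i x| ≤ c * t) (fun l => by
        refine DefPred.forall_real (p := fun (x : Fin n → ℝ) t => 0 < t → t < 1 / ((l : ℝ) + 1) →
          ∀ i j, |f i (Function.update x j (x j + t)) - f i x| ≤ c * t) ?_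
        refine DefPred.imp ((DefFun.const 0).lt hL (DefFun.var none)) ?_
        refine DefPred.imp ((DefFun.var none).lt hL (DefFun.const _)) ?_
        refine DefPred.forall_finite fun i => DefPred.forall_finite fun j => ?_
        exact DefFun.abs_le hL (((hf i).app_of_defFun
          (DefFun.update (fun j => DefFun.var (some j)) j
            ((DefFun.var (some j)).add hL (DefFun.var none)))).sub hL
              ((hf i).app_of_defFun fun j => DefFun.var (some j)))
                ((DefFun.const c).mul hL (DefFun.var none))) hab
    (fun x hx => HoldsNearZero.exists_nat (by
      simp only [holdsNearZero_iff_eventually] at h ⊢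
      exact Filter.eventually_all.2 fun i => Filter.eventually_all.2 fun j => h x hx i j))
  have hl : (0 : ℝ) < 1 / ((l : ℝ) + 1) := by positivity
  set b₂ : Fin n → ℝ := fun i => min (b₁ i) (a₁ i + 1 / ((l : ℝ) + 1)) with hb₂
  have hab₂ : ∀ i, a₁ i < b₂ i := fun i => lt_min (hab₁ i) (by linarith)
  have hsub₂ : openBox a₁ b₂ ⊆ openBox a₁ b₁ := fun x hx i =>
    ⟨(hx i).1, (hx i).2.trans_le (min_le_left _ _)⟩
  have hup : ∀ i, ∀ x ∈ openBox a₁ b₂, ∀ j τ, x j < τ → τ < b₂ j →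
      |f i (Function.update x j τ) - f i x| ≤ c * (τ - x j) := by
    intro i x hx j τ h1 h2
    have h3 : τ < a₁ j + 1 / ((l : ℝ) + 1) := h2.trans_le (min_le_right _ _)
    have := h₁ x (hsub₂ hx) (τ - x j) (by linarith) (by linarith [(hx j).1]) i j
    simpa using this
  have hstep : ∀ i, ∀ x ∈ openBox a₁ b₂, ∀ j τ, a₁ j < τ → τ < b₂ j →
      |f i (Function.update x j τ) - f i x| ≤ c * |τ - x j| := by
    intro i x hx j τ h1 h2
    rcases lt_trichotomy (x j) τ with hlt | heq | hgt
    · rw [abs_of_pos (sub_pos.2 hlt)]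
      exact hup i x hx j τ hlt h2
    · simp [← heq]
    · have := hup i _ (update_mem_openBox hx h1 h2) j (x j) (by simpa using hgt) (hx j).2
      rw [abs_sub_comm τ, abs_of_pos (sub_pos.2 hgt), abs_sub_comm]
      simpa using this
  obtain ⟨a', b', hab', hsub, h'⟩ := exists_openBox_differentiableAt hL hf hc hab₂ hstep
  refine ⟨a', b', hab', hsub.trans (hsub₂.trans hsub₁), fun x hx i => ⟨h' x hx i, fun j => ?_⟩⟩
  refine norm_deriv_le_of_lip' (f := fun τ => f i (Function.update x j τ)) hc ?_
  filter_upwards [Ioo_mem_nhds (hsub hx j).1 (hsub hx j).2] with τ hτ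
  simpa using hstep i x (hsub hx) j τ hτ.1 hτ.2

/-- Multiplication by `1` or `-1`. -/
def signed (σ : Bool) (y : ℝ) : ℝ := (bif σ then 1 else -1) * y

theorem abs_signed (σ : Bool) (y : ℝ) : |signed σ y| = |y| := by
  cases σ <;> simp [signed]

/-- The possible behaviours at `(x, s)` of the increments of a parametrized map: `none` means
that no right increment has slope at least `c` in absolute value, and `some (i, j, σ, τ)` that
the `i`-th component is steep to the right along the `j`-th axis with sign `σ`, while it is
(for `τ = true`) or is not (for `τ = false`) steep to the left. -/
def SlopeType {m : ℕ} (c : ℝ) (f : Fin m → (Fin n → ℝ) → ℝ → ℝ) :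
    Option (Fin m × Fin n × Bool × Bool) → (Fin n → ℝ) → ℝ → Prop
  | none => fun x s => ∀ i j σ, ¬ RightSteep c (fun y => signed σ (f i y s)) j x
  | some (i, j, σ, true) => fun x s => RightSteep c (fun y => signed σ (f i y s)) j x ∧
      LeftSteep c (fun y => signed σ (f i y s)) j x
  | some (i, j, σ, false) => fun x s => RightSteep c (fun y => signed σ (f i y s)) j x ∧
      ¬ LeftSteep c (fun y => signed σ (f i y s)) j x

theorem exists_slopeType {m : ℕ} (c : ℝ) (f : Fin m → (Fin n → ℝ) → ℝ → ℝ) (x : Fin n → ℝ)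
    (s : ℝ) : ∃ k, SlopeType c f k x s := by
  by_cases h : ∀ i j σ, ¬ RightSteep c (fun y => signed σ (f i y s)) j x
  · exact ⟨none, h⟩
  · push Not at h
    obtain ⟨i, j, σ, h⟩ := h
    by_cases h' : LeftSteep c (fun y => signed σ (f i y s)) j x
    · exact ⟨some (i, j, σ, true), h, h'⟩
    · exact ⟨some (i, j, σ, false), h, h'⟩

theorem DefPred.slopeType (hL : IsOMinimalOn L) {m : ℕ} {f : Fin m → (Fin n → ℝ) → ℝ → ℝ}
    (hf : ∀ i, DefFun L fun w : Fin n ⊕ Fin 1 → ℝ => f i (fun j => w (.inl j)) (w (.inr 0)))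
    (c : ℝ) (k : Option (Fin m × Fin n × Bool × Bool)) {α : Type} [Finite α]
    {X : (α → ℝ) → Fin n → ℝ} (hX : ∀ j, DefFun L fun v => X v j) {S : (α → ℝ) → ℝ}
    (hS : DefFun L S) : DefPred L fun v => SlopeType c f k (X v) (S v) := by
  have hG : ∀ i σ, DefFun L fun w : Fin n ⊕ Fin 1 → ℝ =>
      signed σ (f i (fun j => w (.inl j)) (w (.inr 0))) := fun i σ =>
    (DefFun.const _).mul hL (hf i)
  have hR := fun i j σ => DefPred.rightSteep hL
    (G := fun x s => signed σ (f i x s)) (hG i σ) c j hX hS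
  have hLft := fun i j σ => DefPred.leftSteep hL
    (G := fun x s => signed σ (f i x s)) (hG i σ) c j hX hS
  rcases k with _ | ⟨i, j, σ, _ | _⟩
  · exact DefPred.forall_finite fun i => DefPred.forall_finite fun j =>
      DefPred.forall_finite fun σ => (hR i j σ).not
  · exact (hR i j σ).and (hLft i j σ).not
  · exact (hR i j σ).and (hLft i j σ)

/-- Some slope type occurs on an open box simultaneously for all small parameters. -/
theorem exists_openBox_slopeType (hL : IsOMinimalOn L) {m : ℕ}
    {f : Fin m → (Fin n → ℝ) → ℝ → ℝ}
    (hf : ∀ i, DefFun L fun w : Fin n ⊕ Fin 1 → ℝ => f i (fun j => w (.inl j)) (w (.inr 0)))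
    (c : ℝ) {a b : Fin n → ℝ} (hab : ∀ i, a i < b i) :
    ∃ k, ∃ a' b' : Fin n → ℝ, (∀ i, a' i < b' i) ∧ openBox a' b' ⊆ openBox a b ∧
      HoldsNearZero fun s => ∀ x ∈ openBox a' b', SlopeType c f k x s := by
  obtain ⟨⟨k, l⟩, a', b', hab', hsub, h⟩ := exists_openBox_of_countable_cover hL
    (A := fun (q : Option (Fin m × Fin n × Bool × Bool) × ℕ) x =>
      ∀ s, 0 < s → s < 1 / ((q.2 : ℝ) + 1) → SlopeType c f q.1 x s) (fun q => by
        refine DefPred.forall_real (p := fun (x : Fin n → ℝ) s =>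
          0 < s → s < 1 / ((q.2 : ℝ) + 1) → SlopeType c f q.1 x s) ?_
        refine DefPred.imp ((DefFun.const 0).lt hL (DefFun.var none)) ?_
        refine DefPred.imp ((DefFun.var none).lt hL (DefFun.const _)) ?_
        exact DefPred.slopeType hL hf c q.1 (fun j => DefFun.var (some j)) (DefFun.var none)) hab
    (fun x _ => by
      have hk : ∃ k, HoldsNearZero fun s => SlopeType c f k x s := by
        by_contra! hno
        have hnot : ∀ k, HoldsNearZero fun s => ¬ SlopeType c f k x s := fun k =>
          (holdsNearZero_or_not hL (DefPred.slopeType hL hf c k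
            (X := fun (_ : Fin 1 → ℝ) => x) (fun j => DefFun.const _)
              (DefFun.var 0))).resolve_left (hno k)
        simp only [holdsNearZero_iff_eventually] at hnot
        obtain ⟨s, hs⟩ := (Filter.eventually_all.2 hnot).exists
        obtain ⟨k, hk⟩ := exists_slopeType c f x s
        exact hs k hk
      obtain ⟨k, hk⟩ := hk
      obtain ⟨l, hl⟩ := hk.exists_nat
      exact ⟨(k, l), hl⟩)
  exact ⟨k, a', b', hab', hsub, 1 / ((l : ℝ) + 1), by positivity,
    fun s h0 h1 x hx => h x hx s h0 h1⟩

/-- A definable family of maps converging uniformly to zero eventually has small partial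
derivatives on some open box. -/
theorem holdsNearZero_exists_openBox_deriv_le (hL : IsOMinimalOn L) {m : ℕ}
    {f : Fin m → (Fin n → ℝ) → ℝ → ℝ}
    (hf : ∀ i, DefFun L fun w : Fin n ⊕ Fin 1 → ℝ => f i (fun j => w (.inl j)) (w (.inr 0)))
    {a b : Fin n → ℝ} (hab : ∀ i, a i < b i)
    (hsmall : ∀ η > 0, HoldsNearZero fun s => ∀ x ∈ openBox a b, ∀ i, |f i x s| ≤ η)
    {c : ℝ} (hc : 0 < c) :
    HoldsNearZero fun s => ∃ a' b' : Fin n → ℝ, (∀ i, a' i < b' i) ∧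
      openBox a' b' ⊆ openBox a b ∧ ∀ x ∈ openBox a' b', ∀ i,
        DifferentiableAt ℝ (fun y => f i y s) x ∧
          ∀ j, |deriv (fun τ => f i (Function.update x j τ) s) (x j)| ≤ c := by
  have hfs : ∀ i s, DefFun L fun x : Fin n → ℝ => f i x s := fun i s =>
    DefFun.app (hf i) (fun j => DefFun.var j) (DefFun.const s)
  have hG : ∀ i σ s, DefFun L fun x : Fin n → ℝ => signed σ (f i x s) := fun i σ s =>
    (DefFun.const _).mul hL (hfs i s)
  obtain ⟨k, a₁, b₁, hab₁, hsub₁, r, hr0, hr⟩ := exists_openBox_slopeType hL hf c hab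
  rcases k with _ | ⟨i, j, σ, _ | _⟩
  · refine ⟨r, hr0, fun s hs0 hsr => ?_⟩
    obtain ⟨a', b', hab', hsub', h'⟩ := exists_openBox_deriv_le hL (f := fun i x => f i x s)
      (fun i => hfs i s) hc.le hab₁ (fun x hx i j => by
        have hns : ∀ σ, HoldsNearZero fun t => ¬ c * t ≤
            signed σ (f i (Function.update x j (x j + t)) s) - signed σ (f i x s) := fun σ => by
          refine (holdsNearZero_or_not hL ?_).resolve_left (hr s hs0 hsr x hx i j σ)
          refine ((DefFun.const c).mul hL (DefFun.var 0)).le hL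
            (((hG i σ s).app_of_defFun ?_).sub hL (DefFun.const _))
          exact DefFun.update (fun j => DefFun.const (x j)) j
            ((DefFun.const (x j)).add hL (DefFun.var 0))
        have h1 := hns true
        have h2 := hns false
        rw [holdsNearZero_iff_eventually] at h1 h2 ⊢
        filter_upwards [h1, h2] with t ht1 ht2
        simp only [signed, cond_true, cond_false] at ht1 ht2
        rw [abs_le]
        constructor <;> linarith)
    exact ⟨a', b', hab', hsub'.trans hsub₁, h'⟩
  · exfalso
    have hr' := hr (r / 2) (by linarith) (by linarith)
    obtain ⟨x, hx, hleft⟩ := exists_leftSteep_of_rightSteep hL (hG i σ (r / 2)) hab₁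
      fun x hx => (hr' x hx).1
    exact (hr' x hx).2 hleft
  · exfalso
    obtain ⟨x, hx⟩ := openBox_nonempty hab₁
    set d := (b₁ j - x j) / 2 with hd
    have hd0 : 0 < d := by linarith [(hx j).2]
    obtain ⟨δ, hδ0, hδ⟩ := hsmall (c * d / 4) (by positivity)
    set s := min r δ / 2 with hs
    have hmin : 0 < min r δ := lt_min hr0 hδ0
    have hs0 : 0 < s := by linarith
    have hsr : s < r := by linarith [min_le_left r δ]
    have hsδ : s < δ := by linarith [min_le_right r δ]
    have hmem : ∀ τ, x j ≤ τ → τ ≤ x j + d → Function.update x j τ ∈ openBox a₁ b₁ :=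
      fun τ h1 h2 => update_mem_openBox hx ((hx j).1.trans_le h1) (by linarith)
    have hsteep := mul_sub_le_of_locally_steep
      (h := fun τ => signed σ (f i (Function.update x j τ) s)) (c := c) (a := x j) (b := x j + d)
      (fun τ h1 h2 => by simpa [RightSteep] using (hr s hs0 hsr _ (hmem τ h1 h2)).1)
      (fun τ h1 h2 => by simpa [LeftSteep] using (hr s hs0 hsr _ (hmem τ h1 h2)).2)
      (by linarith)
    have hbound : ∀ y ∈ openBox a₁ b₁, |signed σ (f i y s)| ≤ c * d / 4 := fun y hy => by
      rw [abs_signed]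
      exact hδ s hs0 hsδ y (hsub₁ hy) i
    have h1 := abs_le.1 (hbound _ (hmem (x j) le_rfl (by linarith)))
    have h2 := abs_le.1 (hbound _ (hmem (x j + d) (by linarith) le_rfl))
    have h3 : 0 < c * d := by positivity
    rw [add_sub_cancel_left] at hsteep
    linarith [h1.1, h2.2]

end Increments

theorem sqrt_sum_sum_sq_lt {n m : ℕ} {ε : ℝ} (hε : 0 < ε) {d : Fin m → Fin n → ℝ}
    (hd : ∀ i j, |d i j| ≤ ε / (m * n + 1)) : Real.sqrt (∑ i, ∑ j, d i j ^ 2) < ε := by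
  set c := ε / (m * n + 1) with hc
  have hc0 : 0 < c := by positivity
  have hεc : ε = (m * n + 1) * c := by
    rw [hc]
    field_simp
  have hsum : ∑ i, ∑ j, d i j ^ 2 ≤ m * n * c ^ 2 := by
    calc ∑ i, ∑ j, d i j ^ 2 ≤ ∑ _i : Fin m, ∑ _j : Fin n, c ^ 2 :=
          Finset.sum_le_sum fun i _ => Finset.sum_le_sum fun j _ => by
            rw [← sq_abs]
            exact pow_le_pow_left₀ (abs_nonneg _) (hd i j) 2
      _ = m * n * c ^ 2 := by simp [mul_assoc]
  rw [Real.sqrt_lt' hε]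
  refine hsum.trans_lt ?_
  have hmn : (0 : ℝ) ≤ m * n := by positivity
  have hc2 : 0 < c ^ 2 := by positivity
  rw [hεc, mul_pow]
  refine mul_lt_mul_of_pos_right ?_ hc2
  nlinarith

open Classical in
/-- The `i`-th component of a map on `(-1, 1)ⁿ × (0, 1)`, extended by zero. -/
def zeroExtend {n m : ℕ} (F : (Fin n → ℝ) → ℝ → Fin m → ℝ) (i : Fin m) (x : Fin n → ℝ)
    (s : ℝ) : ℝ :=
  if (∀ j, x j ∈ Ioo (-1 : ℝ) 1) ∧ s ∈ Ioo (0 : ℝ) 1 then F x s i else 0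

theorem defFun_zeroExtend {n m : ℕ} {L : FirstOrder.Language} [L.Structure ℝ]
    (hL : IsOMinimalOn L) {F : (Fin n → ℝ) → ℝ → Fin m → ℝ}
    (hF : DefinableT L {v : (Fin n ⊕ Fin 1) ⊕ Fin m → ℝ |
      (∀ j, v (Sum.inl (Sum.inl j)) ∈ Set.Ioo (-1 : ℝ) 1) ∧
      v (Sum.inl (Sum.inr 0)) ∈ Set.Ioo (0 : ℝ) 1 ∧
      ∀ i, v (Sum.inr i) =
        F (fun j => v (Sum.inl (Sum.inl j))) (v (Sum.inl (Sum.inr 0))) i}) (i : Fin m) :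
    DefFun L fun w : Fin n ⊕ Fin 1 → ℝ =>
      zeroExtend F i (fun j => w (.inl j)) (w (.inr 0)) := by
  have hIoo : ∀ (a b : ℝ) (k : Fin n ⊕ Fin 1),
      DefPred L fun w : Option (Fin n ⊕ Fin 1) → ℝ => w (some k) ∈ Ioo a b := fun a b k =>
    ((DefFun.const a).lt hL (DefFun.var _)).and ((DefFun.var _).lt hL (DefFun.const b))
  have hdom : DefPred L fun w : Option (Fin n ⊕ Fin 1) → ℝ =>
      (∀ j, w (some (.inl j)) ∈ Ioo (-1 : ℝ) 1) ∧ w (some (.inr 0)) ∈ Ioo (0 : ℝ) 1 :=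
    (DefPred.forall_finite fun j => hIoo _ _ _).and (hIoo _ _ _)
  have hgraph : DefPred L fun w : Option (Fin n ⊕ Fin 1) → ℝ => ∃ y : Fin m → ℝ,
      y i = w none ∧ ((∀ j, w (some (.inl j)) ∈ Ioo (-1 : ℝ) 1) ∧
        w (some (.inr 0)) ∈ Ioo (0 : ℝ) 1 ∧
          ∀ i, y i = F (fun j => w (some (.inl j))) (w (some (.inr 0))) i) := by
    refine DefPred.exists_block (p := fun (w : Option (Fin n ⊕ Fin 1) → ℝ) (y : Fin m → ℝ) =>
      y i = w none ∧ ((∀ j, w (some (.inl j)) ∈ Ioo (-1 : ℝ) 1) ∧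
        w (some (.inr 0)) ∈ Ioo (0 : ℝ) 1 ∧
          ∀ i, y i = F (fun j => w (some (.inl j))) (w (some (.inr 0))) i)) ?_
    exact (DefPred.var_eq_var _ _).and
      (DefPred.reindex (Sum.map some id : (Fin n ⊕ Fin 1) ⊕ Fin m → _) hF)
  refine (hgraph.or (hdom.not.and (DefPred.var_eq_const none 0))).congr fun w => ?_
  unfold zeroExtend
  beta_reduce
  split_ifs with h
  · constructor
    · intro hw
      exact Or.inl ⟨_, hw.symm, h.1, h.2, fun _ => rfl⟩
    · rintro (⟨y, hy, -, -, hyF⟩ | ⟨h', -⟩)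
      · rw [← hy, hyF]
      · exact absurd h h'
  · constructor
    · exact fun h0 => Or.inr ⟨h, h0⟩
    · rintro (⟨y, -, h1, h2, -⟩ | ⟨-, h0⟩)
      · exact absurd ⟨h1, h2⟩ h
      · exact h0

/-- **Proposition 6.** Let `Q = (-1,1)ⁿ` and let `F : Q × (0,1) → ℝᵐ` be a definable mapping
with `‖F(x,s)‖ → 0` uniformly on `Q` as `s → 0+`. Then for every `ε > 0` there is `δ > 0`
such that for each `s ∈ (0,δ)` there is a nonempty open set `Ω ⊆ Q` on which `F(·,s)` is
differentiable with Frobenius norm of the Jacobian `< ε`. -/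
theorem small_definable_maps_have_small_jacobian_on_open_set
    {n m : ℕ} (L : FirstOrder.Language) [L.Structure ℝ] (hL : IsOMinimalOn L)
    (F : (Fin n → ℝ) → ℝ → (Fin m → ℝ))
    (Q : Set (Fin n → ℝ)) (hQ : Q = {x | ∀ j, x j ∈ Set.Ioo (-1 : ℝ) 1})
    (hFdef : DefinableT L {v : (Fin n ⊕ Fin 1) ⊕ Fin m → ℝ |
      (∀ j, v (Sum.inl (Sum.inl j)) ∈ Set.Ioo (-1 : ℝ) 1) ∧
      v (Sum.inl (Sum.inr 0)) ∈ Set.Ioo (0 : ℝ) 1 ∧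
      ∀ i, v (Sum.inr i) =
        F (fun j => v (Sum.inl (Sum.inl j))) (v (Sum.inl (Sum.inr 0))) i})
    (hunif : ∀ ε > (0 : ℝ), ∃ δ > (0 : ℝ), ∀ s ∈ Set.Ioo (0 : ℝ) 1, s < δ →
      ∀ x ∈ Q, Real.sqrt (∑ i, (F x s i) ^ 2) ≤ ε) :
    ∀ ε > (0 : ℝ), ∃ δ > (0 : ℝ), ∀ s ∈ Set.Ioo (0 : ℝ) 1, s < δ →
      ∃ Ω : Set (Fin n → ℝ), IsOpen Ω ∧ Ω.Nonempty ∧ Ω ⊆ Q ∧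
        ∀ x ∈ Ω, DifferentiableAt ℝ (fun x' => F x' s) x ∧
          Real.sqrt (∑ i, ∑ j,
            (deriv (fun τ => F (Function.update x j τ) s i) (x j)) ^ 2) < ε := by
  intro ε hε
  have hbox : openBox (fun _ => -1) (fun _ => 1) = Q := by
    rw [hQ]
    rfl
  have hext : ∀ s ∈ Ioo (0 : ℝ) 1, ∀ x ∈ Q, ∀ i, zeroExtend F i x s = F x s i := by
    intro s hs x hx i
    rw [hQ] at hx
    exact if_pos ⟨hx, hs⟩
  have hsmall : ∀ η > 0, HoldsNearZero fun s =>
      ∀ x ∈ openBox (fun _ : Fin n => (-1 : ℝ)) fun _ => 1, ∀ i, |zeroExtend F i x s| ≤ η := by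
    intro η hη
    obtain ⟨δ, hδ0, hδ⟩ := hunif η hη
    refine ⟨min δ 1, lt_min hδ0 one_pos, fun s h0 h1 x hx i => ?_⟩
    rw [hbox] at hx
    have hs : s ∈ Ioo (0 : ℝ) 1 := ⟨h0, h1.trans_le (min_le_right _ _)⟩
    rw [hext s hs x hx]
    refine le_trans (Real.abs_le_sqrt ?_) (hδ s hs (h1.trans_le (min_le_left _ _)) x hx)
    exact Finset.single_le_sum (f := fun i => F x s i ^ 2) (fun i _ => sq_nonneg _)
      (Finset.mem_univ i)
  obtain ⟨δ, hδ0, hδ⟩ := holdsNearZero_exists_openBox_deriv_le hL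
    (f := zeroExtend F) (fun i => defFun_zeroExtend hL hFdef i)
    (fun _ => by norm_num) hsmall (show 0 < ε / (m * n + 1) by positivity)
  refine ⟨δ, hδ0, fun s hs hsδ => ?_⟩
  obtain ⟨a, b, hab, hsub, h⟩ := hδ s hs.1 hsδ
  rw [hbox] at hsub
  refine ⟨openBox a b, isOpen_openBox a b, openBox_nonempty hab, hsub, fun x hx => ⟨?_, ?_⟩⟩
  · refine differentiableAt_pi.2 fun i => ((h x hx i).1).congr_of_eventuallyEq ?_
    filter_upwards [(isOpen_openBox a b).mem_nhds hx] with y hy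
    exact (hext s hs y (hsub hy) i).symm
  · refine sqrt_sum_sum_sq_lt hε fun i j => ?_
    have heq : (fun τ => F (Function.update x j τ) s i) =ᶠ[𝓝 (x j)]
        fun τ => zeroExtend F i (Function.update x j τ) s := by
      filter_upwards [Ioo_mem_nhds (hx j).1 (hx j).2] with τ hτ
      exact (hext s hs _ (hsub (update_mem_openBox hx hτ.1 hτ.2)) i).symm
    rw [heq.deriv_eq]
    exact (h x hx i).2 j
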